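/- Assume the time-varying graph G[A(·)] is cut-balanced, and let V_r be a strongly connected component of the graph of essential interactions 𝒢, with ℰ_r⁺ and ℰ_r⁻ its sets of essentially cooperating and essentially competing pairs inside V_r. Then for any solution x of ẋ(t) = −L[A(t)]x(t) the limits x_i† = lim_{t→∞} x_i(t) exist for all i, and |x_i†| = |x_j†| whenever i,j ∈ V_r. If ℰ_r⁺ ∩ ℰ_r⁻ = ∅ and the signed graph 𝒢_r^± is structurally balanced with camps V_r = V_r¹ ∪ V_r², then x_i† = x_j† for i,j in the same camp and x_i† = −x_j† for i ∈ V_r¹, j ∈ V_r² (consensus within V_r when ℰ_r⁻ = ∅, polarization otherwise). If instead ℰ_r⁺ ∩ ℰ_r⁻ ≠ ∅ or 𝒢_r^± is structurally unbalanced, then x_i† = 0 for all i ∈ V_r. -/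

import Mathlib

open MeasureTheory Filter Matrix Finset Topology

/-- The signed Laplacian `L[A]` of a signed adjacency matrix:
off-diagonal entries `L j k = -A j k`, diagonal entries `L j j = ∑ m, |A j m|`. -/
noncomputable def sLap {N : ℕ} (A : Matrix (Fin N) (Fin N) ℝ) : Matrix (Fin N) (Fin N) ℝ :=
  fun j k => if j = k then ∑ m, |A j m| else -A j k

/-- A time-varying signed adjacency matrix: entrywise measurable, locally bounded,
with zero diagonal. -/
def IsAdjacency {N : ℕ} (A : ℝ → Matrix (Fin N) (Fin N) ℝ) : Prop :=
  (∀ j k, Measurable fun t => A t j k) ∧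
  (∀ T : ℝ, ∃ C : ℝ, ∀ t ∈ Set.Icc (0:ℝ) T, ∀ j k, |A t j k| ≤ C) ∧
  (∀ t j, A t j j = 0)

/-- A solution of `ẋ = −L[A(t)]x` on `[0,∞)`: continuous and satisfying the integral
equation (equivalently, locally absolutely continuous and satisfying the ODE a.e.). -/
def IsSolution {N : ℕ} (A : ℝ → Matrix (Fin N) (Fin N) ℝ) (x : ℝ → Fin N → ℝ) : Prop :=
  ContinuousOn x (Set.Ici 0) ∧
  ∀ t ∈ Set.Ici (0:ℝ), ∀ j,
    x t j = x 0 j + ∫ s in (0:ℝ)..t, -((sLap (A s)).mulVec (x s) j)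

/-- Quasi-strong connectivity of the static signed graph `G[A]`: some root reaches
every node along arcs `k → j` present whenever `A j k ≠ 0`. -/
def QSC {N : ℕ} (A : Matrix (Fin N) (Fin N) ℝ) : Prop :=
  ∃ r : Fin N, ∀ j : Fin N, Relation.ReflTransGen (fun k j => A j k ≠ 0) r j

/-- Structural balance of the static signed graph `G[A]`: the nodes split into the camp `S`
and its complement (one possibly empty), with nonnegative weights inside a camp and
nonpositive weights between camps. -/
def StructBal {N : ℕ} (A : Matrix (Fin N) (Fin N) ℝ) : Prop :=
  ∃ S : Set (Fin N), ∀ j k : Fin N,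
    ((j ∈ S ↔ k ∈ S) → 0 ≤ A j k) ∧ (¬(j ∈ S ↔ k ∈ S) → A j k ≤ 0)

/-- `∫_0^∞ |a_{jk}(t)| dt = ∞`: arc `k → j` of the graph of essential interactions. -/
def EssArc {N : ℕ} (A : ℝ → Matrix (Fin N) (Fin N) ℝ) (j k : Fin N) : Prop :=
  ∫⁻ t in Set.Ici (0:ℝ), ENNReal.ofReal |A t j k| = ⊤

/-- `∫_0^∞ a_{jk}⁺(t) dt = ∞`: agents `j` and `k` essentially cooperate. -/
def EssPlus {N : ℕ} (A : ℝ → Matrix (Fin N) (Fin N) ℝ) (j k : Fin N) : Prop :=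
  ∫⁻ t in Set.Ici (0:ℝ), ENNReal.ofReal (max (A t j k) 0) = ⊤

/-- `∫_0^∞ a_{jk}⁻(t) dt = ∞`: agents `j` and `k` essentially compete. -/
def EssMinus {N : ℕ} (A : ℝ → Matrix (Fin N) (Fin N) ℝ) (j k : Fin N) : Prop :=
  ∫⁻ t in Set.Ici (0:ℝ), ENNReal.ofReal (max (-(A t j k)) 0) = ⊤

/-- Reachability from `u` to `v` in the graph of essential interactions. -/
def EssReach {N : ℕ} (A : ℝ → Matrix (Fin N) (Fin N) ℝ) (u v : Fin N) : Prop :=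
  Relation.ReflTransGen (fun k j => EssArc A j k) u v

/-- Uniform strong connectivity of the time-varying graph `G[A(·)]`. -/
def USC {N : ℕ} (A : ℝ → Matrix (Fin N) (Fin N) ℝ) : Prop :=
  ∃ T > (0:ℝ), ∃ ε > (0:ℝ), ∀ t ≥ (0:ℝ), ∀ u v : Fin N,
    Relation.ReflTransGen (fun k j => ε ≤ ∫ s in t..(t + T), |A s j k|) u v

/-- Uniform quasi-strong connectivity of the time-varying graph `G[A(·)]`. -/
def UQSC {N : ℕ} (A : ℝ → Matrix (Fin N) (Fin N) ℝ) : Prop :=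
  ∃ T > (0:ℝ), ∃ ε > (0:ℝ), ∀ t ≥ (0:ℝ), ∃ r : Fin N, ∀ j : Fin N,
    Relation.ReflTransGen (fun k j => ε ≤ ∫ s in t..(t + T), |A s j k|) r j

/-- Cut-balance of the time-varying graph `G[A(·)]` with some constant `K ≥ 1`. -/
def CutBalanced {N : ℕ} (A : ℝ → Matrix (Fin N) (Fin N) ℝ) : Prop :=
  ∃ K : ℝ, 1 ≤ K ∧ ∀ᵐ t ∂(volume.restrict (Set.Ici (0:ℝ))),
    ∀ V : Finset (Fin N), V.Nonempty → V ≠ Finset.univ →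
      K⁻¹ * (∑ j ∈ V, ∑ k ∈ Vᶜ, |A t k j|) ≤ (∑ j ∈ V, ∑ k ∈ Vᶜ, |A t j k|) ∧
      (∑ j ∈ V, ∑ k ∈ Vᶜ, |A t j k|) ≤ K * (∑ j ∈ V, ∑ k ∈ Vᶜ, |A t k j|)

/-- The protocol establishes modulus consensus: the moduli of all opinions converge
to a common limit for every solution. -/
def ModulusConsensus {N : ℕ} (A : ℝ → Matrix (Fin N) (Fin N) ℝ) : Prop :=
  ∀ x : ℝ → Fin N → ℝ, IsSolution A x →
    ∃ c : ℝ, 0 ≤ c ∧ ∀ i, Tendsto (fun t => |x t i|) atTop (𝓝 c)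

/-- The protocol establishes bipartite consensus: there are `v ≠ 0` and `ρ ∈ {±1}^N` such that
every solution converges to `ρ (vᵀ x(0))`. -/
def BipartiteConsensus {N : ℕ} (A : ℝ → Matrix (Fin N) (Fin N) ℝ) : Prop :=
  ∃ v ρ : Fin N → ℝ, v ≠ 0 ∧ (∀ i, ρ i = 1 ∨ ρ i = -1) ∧
    ∀ x : ℝ → Fin N → ℝ, IsSolution A x →
      ∀ i, Tendsto (fun t => x t i) atTop (𝓝 (ρ i * ∑ j, v j * x 0 j))

/-- The essential-interaction signed graph `𝒢^±` is structurally balanced: the camp `S` and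
its complement contain all essentially-cooperating pairs inside a camp and all
essentially-competing pairs between the camps. -/
def EssStructBal {N : ℕ} (A : ℝ → Matrix (Fin N) (Fin N) ℝ) : Prop :=
  ∃ S : Set (Fin N),
    (∀ j k, EssPlus A j k → (j ∈ S ↔ k ∈ S)) ∧
    (∀ j k, EssMinus A j k → ¬(j ∈ S ↔ k ∈ S))

lemma sum_sum_ite_mem {ι : Type*} [Fintype ι] [DecidableEq ι] (P Q : Finset ι) (g : ι → ι → ℝ) :
    ∑ j, ∑ k, (if j ∈ P then (if k ∈ Q then g j k else 0) else 0) = ∑ j ∈ P, ∑ k ∈ Q, g j k := by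
  have h : ∀ j, ∑ k, (if j ∈ P then (if k ∈ Q then g j k else 0) else 0) =
      if j ∈ P then ∑ k ∈ Q, g j k else 0 := by
    intro j
    by_cases hj : j ∈ P <;> simp [hj]
  simp [h]

/-- Weighted cut estimate: for the indicator of a top-rank set, geometrically decaying weights
turn cut balance into a strict decrease. -/
lemma cut_estimate {N : ℕ} {c : Fin N → Fin N → ℝ} (hc : ∀ j k, 0 ≤ c j k) {K : ℝ} (hK : 1 ≤ K)
    (hcb : ∀ V : Finset (Fin N), V.Nonempty → V ≠ Finset.univ →
      K⁻¹ * (∑ j ∈ V, ∑ k ∈ Vᶜ, c k j) ≤ ∑ j ∈ V, ∑ k ∈ Vᶜ, c j k)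
    {r : Fin N → ℕ} (hr : ∀ j, r j < N) {q δ : ℝ} (hq : q = (2 * K)⁻¹)
    (hδ : δ = q ^ N / (2 * (K + 1))) (m : ℕ) :
    ∑ j, ∑ k, (q ^ r j * c j k * ((if r k ≤ m then 1 else 0) - (if r j ≤ m then 1 else 0)) +
      δ * c j k * |(if r k ≤ m then (1 : ℝ) else 0) - (if r j ≤ m then 1 else 0)|) ≤ 0 := by
  have hq0 : 0 < q := by rw [hq]; positivity
  have hq1 : q ≤ 1 := by rw [hq]; exact inv_le_one_of_one_le₀ (by linarith)
  have hδ0 : 0 < δ := by rw [hδ]; positivity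
  set T : Finset (Fin N) := Finset.univ.filter fun j => r j ≤ m with hT
  have hmem : ∀ j, j ∈ T ↔ r j ≤ m := by simp [hT]
  by_cases hTu : T = Finset.univ
  · have h1 : ∀ j, r j ≤ m := fun j => (hmem j).1 (by simp [hTu])
    simp [h1]
  by_cases hTe : T = ∅
  · have h1 : ∀ j, ¬ r j ≤ m := fun j h => by have := (hmem j).2 h; simp [hTe] at this
    simp [h1]
  have hmN : m < N := by
    by_contra h
    exact hTu (Finset.eq_univ_of_forall fun j => (hmem j).2 (by have := hr j; omega))
  have hcut := hcb T (Finset.nonempty_iff_ne_empty.2 hTe) hTu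
  set Sout := ∑ j ∈ T, ∑ k ∈ Tᶜ, c j k with hSout
  set Sin := ∑ j ∈ T, ∑ k ∈ Tᶜ, c k j with hSin
  have hSout0 : 0 ≤ Sout := Finset.sum_nonneg fun j _ => Finset.sum_nonneg fun k _ => hc j k
  have hin : Sin ≤ K * Sout := by
    rwa [inv_mul_le_iff₀ (by linarith)] at hcut
  have hbound : ∑ j, ∑ k, (q ^ r j * c j k *
        ((if r k ≤ m then 1 else 0) - (if r j ≤ m then 1 else 0)) +
      δ * c j k * |(if r k ≤ m then (1 : ℝ) else 0) - (if r j ≤ m then 1 else 0)|) ≤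
      ∑ j, ∑ k, ((q ^ (m + 1) + δ) * (if j ∈ Tᶜ then (if k ∈ T then c j k else 0) else 0) -
        (q ^ m - δ) * (if j ∈ T then (if k ∈ Tᶜ then c j k else 0) else 0)) := by
    refine Finset.sum_le_sum fun j _ => Finset.sum_le_sum fun k _ => ?_
    simp only [Finset.mem_compl, hmem]
    have hcj := hc j k
    by_cases h1 : r j ≤ m <;> by_cases h2 : r k ≤ m <;> simp only [h1, h2, if_true, if_false, not_true,
      not_false_iff] <;> norm_num
    · have : q ^ m ≤ q ^ r j := pow_le_pow_of_le_one hq0.le hq1 h1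
      nlinarith
    · have : q ^ r j ≤ q ^ (m + 1) := pow_le_pow_of_le_one hq0.le hq1 (by omega)
      nlinarith
  have hsin' : ∑ j, ∑ k, (if j ∈ Tᶜ then (if k ∈ T then c j k else 0) else 0) = Sin := by
    rw [sum_sum_ite_mem, hSin, Finset.sum_comm]
  have hsout' : ∑ j, ∑ k, (if j ∈ T then (if k ∈ Tᶜ then c j k else 0) else 0) = Sout :=
    sum_sum_ite_mem T Tᶜ c
  simp only [Finset.sum_sub_distrib, ← Finset.mul_sum, hsin', hsout'] at hbound
  refine hbound.trans ?_
  have hKq : q ^ (m + 1) * K = q ^ m / 2 := by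
    rw [pow_succ, hq]; field_simp
  have hδK : δ * (K + 1) ≤ q ^ m / 2 := by
    have : q ^ N ≤ q ^ m := pow_le_pow_of_le_one hq0.le hq1 hmN.le
    rw [hδ]; field_simp; linarith
  have : (q ^ (m + 1) + δ) * Sin ≤ (q ^ (m + 1) + δ) * (K * Sout) := by gcongr
  nlinarith

/-- Pairwise form of `cut_estimate` for values sorted by rank. -/
lemma sorted_estimate {N : ℕ} {c : Fin N → Fin N → ℝ} (hc : ∀ j k, 0 ≤ c j k) {K : ℝ} (hK : 1 ≤ K)
    (hcb : ∀ V : Finset (Fin N), V.Nonempty → V ≠ Finset.univ →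
      K⁻¹ * (∑ j ∈ V, ∑ k ∈ Vᶜ, c k j) ≤ ∑ j ∈ V, ∑ k ∈ Vᶜ, c j k)
    {r : Fin N → ℕ} (hr : ∀ j, r j < N) {q δ : ℝ} (hq : q = (2 * K)⁻¹)
    (hδ : δ = q ^ N / (2 * (K + 1))) {U : ℕ → ℝ} (hU : Antitone U) :
    ∑ j, ∑ k, (q ^ r j * c j k * (U (r k) - U (r j)) + δ * c j k * |U (r k) - U (r j)|) ≤ 0 := by
  have hq0 : 0 < q := by rw [hq]; positivity
  have hδ0 : 0 < δ := by rw [hδ]; positivity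
  have hg : ∀ m, 0 ≤ U m - U (m + 1) := fun m => sub_nonneg.2 (hU m.le_succ)
  have hlayer : ∀ i ≤ N, U i = U N + ∑ m ∈ range N, (U m - U (m + 1)) * (if i ≤ m then 1 else 0) := by
    intro i hi
    simp only [mul_ite, mul_one, mul_zero, ← Finset.sum_filter]
    have : (range N).filter (fun m => i ≤ m) = Finset.Ico i N := by
      ext m; simp [and_comm]
    rw [this]
    have := Finset.sum_Ico_sub U hi
    have h2 : ∑ m ∈ Finset.Ico i N, (U m - U (m + 1)) = -∑ m ∈ Finset.Ico i N, (U (m + 1) - U m) := by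
      rw [← Finset.sum_neg_distrib]; simp
    rw [h2, this]; ring
  have hdiff : ∀ j k, U (r k) - U (r j) = ∑ m ∈ range N, (U m - U (m + 1)) *
      ((if r k ≤ m then 1 else 0) - (if r j ≤ m then 1 else 0)) := by
    intro j k
    rw [hlayer _ (hr j).le, hlayer _ (hr k).le]
    simp only [mul_sub, Finset.sum_sub_distrib]; ring
  have habs : ∀ j k, |U (r k) - U (r j)| ≤ ∑ m ∈ range N, (U m - U (m + 1)) *
      |(if r k ≤ m then 1 else 0) - (if r j ≤ m then (1 : ℝ) else 0)| := by
    intro j k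
    rw [hdiff]
    refine (Finset.abs_sum_le_sum_abs _ _).trans (Finset.sum_le_sum fun m _ => ?_)
    rw [abs_mul, abs_of_nonneg (hg m)]
  calc _ ≤ ∑ j, ∑ k, ∑ m ∈ range N, (U m - U (m + 1)) *
        (q ^ r j * c j k * ((if r k ≤ m then 1 else 0) - (if r j ≤ m then 1 else 0)) +
      δ * c j k * |(if r k ≤ m then (1 : ℝ) else 0) - (if r j ≤ m then 1 else 0)|) := by
        refine Finset.sum_le_sum fun j _ => Finset.sum_le_sum fun k _ => ?_
        have h1 := mul_le_mul_of_nonneg_left (habs j k) (mul_nonneg hδ0.le (hc j k))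
        refine (add_le_add_right h1 _).trans (le_of_eq ?_)
        rw [hdiff j k, Finset.mul_sum, Finset.mul_sum, ← Finset.sum_add_distrib]
        exact Finset.sum_congr rfl fun m _ => by ring
    _ = ∑ m ∈ range N, (U m - U (m + 1)) * ∑ j, ∑ k,
        (q ^ r j * c j k * ((if r k ≤ m then 1 else 0) - (if r j ≤ m then 1 else 0)) +
      δ * c j k * |(if r k ≤ m then (1 : ℝ) else 0) - (if r j ≤ m then 1 else 0)|) := by
        simp only [Finset.mul_sum]
        rw [Finset.sum_comm (s := range N)]
        exact Finset.sum_congr rfl fun j _ => Finset.sum_comm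
    _ ≤ 0 := Finset.sum_nonpos fun m _ =>
        mul_nonpos_of_nonneg_of_nonpos (hg m) (cut_estimate hc hK hcb hr hq hδ m)

/-- The linear functional `x ↦ ∑ j, q ^ σ(j) ε_j x_j` attached to a ranking `σ` and signs `ε`. -/
noncomputable def rankFunctional {N : ℕ} (q : ℝ) (p : Equiv.Perm (Fin N) × (Fin N → SignType)) :
    (Fin N → ℝ) →L[ℝ] ℝ :=
  ∑ j, (q ^ (p.1 j : ℕ) * (p.2 j : ℝ)) • ContinuousLinearMap.proj j

lemma rankFunctional_apply {N : ℕ} (q : ℝ) (p : Equiv.Perm (Fin N) × (Fin N → SignType))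
    (x : Fin N → ℝ) : rankFunctional q p x = ∑ j, q ^ (p.1 j : ℕ) * (p.2 j : ℝ) * x j := by
  simp [rankFunctional]

/-- All the functionals `rankFunctional q p` together; the sup norm of its value is the Lyapunov
function `max_σ ∑ j, q ^ σ(j) |x_j|`. -/
noncomputable def rankMap {N : ℕ} (q : ℝ) :
    (Fin N → ℝ) →L[ℝ] (Equiv.Perm (Fin N) × (Fin N → SignType) → ℝ) :=
  ContinuousLinearMap.pi (rankFunctional q)

lemma abs_rankFunctional_le {N : ℕ} (q : ℝ) (p : Equiv.Perm (Fin N) × (Fin N → SignType))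
    (x : Fin N → ℝ) : |rankFunctional q p x| ≤ ‖rankMap q x‖ :=
  norm_le_pi_norm (rankMap q x) p

/-- The Lyapunov function is attained by ranking the moduli in decreasing order. -/
lemma norm_rankMap_eq {N : ℕ} {q : ℝ} (hq0 : 0 < q) (hq1 : q ≤ 1) (x : Fin N → ℝ)
    (σ : Equiv.Perm (Fin N)) (hσ : ∀ j k, σ j ≤ σ k → |x k| ≤ |x j|) :
    ‖rankMap q x‖ = rankFunctional q (σ, fun j => SignType.sign (x j)) x := by
  have hval : rankFunctional q (σ, fun j => SignType.sign (x j)) x =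
      ∑ j, q ^ (σ j : ℕ) * |x j| := by
    simp only [rankFunctional_apply, mul_assoc, sign_mul_self]
  refine le_antisymm ?_ ((le_abs_self _).trans (abs_rankFunctional_le _ _ _))
  rw [hval]
  refine (pi_norm_le_iff_of_nonneg (Finset.sum_nonneg fun j _ => by positivity)).2 fun p => ?_
  have h1 : ‖rankMap q x p‖ ≤ ∑ j, q ^ (p.1 j : ℕ) * |x j| := by
    change |rankFunctional q p x| ≤ _
    rw [rankFunctional_apply]
    refine (Finset.abs_sum_le_sum_abs _ _).trans (Finset.sum_le_sum fun j _ => ?_)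
    rw [abs_mul, abs_mul, abs_of_pos (pow_pos hq0 _)]
    have : |((p.2 j : SignType) : ℝ)| ≤ 1 := by
      cases p.2 j <;> simp
    have hp : 0 < q ^ (p.1 j : ℕ) := pow_pos hq0 _
    calc q ^ (p.1 j : ℕ) * |((p.2 j : SignType) : ℝ)| * |x j| ≤ q ^ (p.1 j : ℕ) * 1 * |x j| := by gcongr
      _ = _ := by ring
  refine h1.trans ?_
  have hmono : Monovary (fun j => q ^ (σ j : ℕ)) (fun j => |x j|) := by
    intro j k hjk
    have : σ k ≤ σ j := by
      by_contra h
      exact absurd (hσ j k (le_of_not_ge h)) (not_le.2 hjk)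
    exact pow_le_pow_of_le_one hq0.le hq1 this
  have := hmono.sum_comp_perm_mul_le_sum_mul (σ := p.1.trans σ.symm)
  simpa using this

/-- Static decrease estimate: along the vector field the active functional decreases at least
proportionally to the total disagreement. -/
lemma exists_active_functional {N : ℕ} (hN : 0 < N) {a : Fin N → Fin N → ℝ} {K : ℝ} (hK : 1 ≤ K)
    (hcb : ∀ V : Finset (Fin N), V.Nonempty → V ≠ Finset.univ →
      K⁻¹ * (∑ j ∈ V, ∑ k ∈ Vᶜ, |a k j|) ≤ ∑ j ∈ V, ∑ k ∈ Vᶜ, |a j k|)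
    {q δ : ℝ} (hq : q = (2 * K)⁻¹) (hδ : δ = q ^ N / (2 * (K + 1))) (x : Fin N → ℝ) :
    ∃ p, ‖rankMap q x‖ = rankFunctional q p x ∧
      rankFunctional q p (fun j => ∑ k, (a j k * x k - |a j k| * x j)) ≤
        -δ * ∑ j, ∑ k, |a j k * x k - |a j k| * x j| := by
  have hq0 : 0 < q := by rw [hq]; positivity
  have hq1 : q ≤ 1 := by rw [hq]; exact inv_le_one_of_one_le₀ (by linarith)
  have hδ0 : 0 < δ := by rw [hδ]; positivity
  set s := Tuple.sort fun j => -|x j|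
  have hmono : Monotone ((fun j => -|x j|) ∘ s) := Tuple.monotone_sort _
  set σ : Equiv.Perm (Fin N) := s.symm with hσ
  have hrank : ∀ j k, σ j ≤ σ k → |x k| ≤ |x j| := by
    intro j k h
    have := hmono h
    simpa [hσ] using this
  refine ⟨(σ, fun j => SignType.sign (x j)), norm_rankMap_eq hq0 hq1 x σ hrank, ?_⟩
  set U : ℕ → ℝ := fun i => |x (s ⟨min i (N - 1), by omega⟩)| with hUdef
  have hU : Antitone U := by
    intro i i' h
    have := hmono (a := ⟨min i (N - 1), by omega⟩) (b := ⟨min i' (N - 1), by omega⟩)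
      (by simp only [Fin.mk_le_mk]; omega)
    simpa using this
  have hUσ : ∀ j, U (σ j) = |x j| := by
    intro j
    have : (⟨min (σ j : ℕ) (N - 1), by omega⟩ : Fin N) = σ j := by
      ext; have := (σ j).2; simp only; omega
    simp only [hUdef, this]
    simp [hσ]
  have hsort := sorted_estimate (c := fun j k => |a j k|) (fun j k => abs_nonneg _) hK hcb
    (r := fun j => (σ j : ℕ)) (fun j => (σ j).2) hq hδ hU
  simp only [hUσ] at hsort
  rw [rankFunctional_apply, neg_mul, le_neg_iff_add_nonpos_right]
  refine le_trans ?_ hsort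
  simp only [Finset.mul_sum, ← Finset.sum_add_distrib]
  refine Finset.sum_le_sum fun j _ => Finset.sum_le_sum fun k _ => ?_
  have hw : δ ≤ q ^ (σ j : ℕ) := by
    have h1 : q ^ N ≤ q ^ (σ j : ℕ) := pow_le_pow_of_le_one hq0.le hq1 (σ j).2.le
    refine le_trans ?_ h1
    rw [hδ]
    exact div_le_self (by positivity) (by linarith)
  have hsx : ((SignType.sign (x j) : SignType) : ℝ) * x j = |x j| := sign_mul_self _
  set e : ℝ := ((SignType.sign (x j) : SignType) : ℝ) with he
  have hres : 0 ≤ |a j k| * |x k| - e * (a j k * x k) := by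
    have : |e| ≤ 1 := by rw [he]; cases SignType.sign (x j) <;> simp
    have h2 : e * (a j k * x k) ≤ |e| * (|a j k| * |x k|) := by
      rw [← abs_mul, ← abs_mul]; exact le_abs_self _
    have := mul_le_mul_of_nonneg_right this (mul_nonneg (abs_nonneg (a j k)) (abs_nonneg (x k)))
    linarith
  have htri : |a j k * x k - |a j k| * x j| ≤
      |a j k| * |(|x k| - |x j|)| + (|a j k| * |x k| - e * (a j k * x k)) := by
    rcases eq_or_ne (x j) 0 with h | h
    · have he0 : e = 0 := by rw [he, h]; simp
      simp [h, he0, abs_mul]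
      positivity
    · have he1 : |e| = 1 := by
        rcases lt_or_gt_of_ne h with h | h <;> rw [he] <;> simp [h]
      have hev : e * (a j k * x k - |a j k| * x j) =
          |a j k| * (|x k| - |x j|) - (|a j k| * |x k| - e * (a j k * x k)) := by
        rw [← hsx]; ring
      calc |a j k * x k - |a j k| * x j| = |e * (a j k * x k - |a j k| * x j)| := by
            rw [abs_mul, he1, one_mul]
        _ ≤ |(|a j k| * (|x k| - |x j|))| + |(|a j k| * |x k| - e * (a j k * x k))| := by
            rw [hev]; exact abs_sub _ _
        _ = _ := by rw [abs_mul, abs_abs, abs_of_nonneg hres]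
  have h3 := mul_le_mul_of_nonneg_left htri hδ0.le
  have h4 := mul_le_mul_of_nonneg_right hw hres
  have h5 : q ^ (σ j : ℕ) * e * (a j k * x k - |a j k| * x j) =
      q ^ (σ j : ℕ) * (e * (a j k * x k)) - q ^ (σ j : ℕ) * |a j k| * |x j| := by
    rw [← hsx]; ring
  rw [h5]
  linarith

/-- Influence of agent `k` on agent `j` at time `s` along the trajectory `x`. -/
def influence {N : ℕ} (A : ℝ → Matrix (Fin N) (Fin N) ℝ) (x : ℝ → Fin N → ℝ) (j k : Fin N)
    (s : ℝ) : ℝ :=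
  A s j k * x s k - |A s j k| * x s j

lemma neg_sLap_mulVec {N : ℕ} {A : ℝ → Matrix (Fin N) (Fin N) ℝ} (hA : IsAdjacency A)
    (x : ℝ → Fin N → ℝ) (s : ℝ) (j : Fin N) :
    -((sLap (A s)).mulVec (x s) j) = ∑ k, influence A x j k s := by
  have h : ∀ k, sLap (A s) j k * x s k =
      (if j = k then (∑ m, |A s j m|) * x s k else 0) - A s j k * x s k := by
    intro k
    by_cases hjk : j = k
    · subst hjk; simp [sLap, hA.2.2]
    · simp [sLap, hjk]
  simp only [Matrix.mulVec, dotProduct, h, influence, Finset.sum_sub_distrib, Finset.sum_ite_eq,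
    Finset.mem_univ, if_true, Finset.sum_mul]
  ring

lemma influence_aestronglyMeasurable {N : ℕ} {A : ℝ → Matrix (Fin N) (Fin N) ℝ}
    (hA : IsAdjacency A) {x : ℝ → Fin N → ℝ} (hx : ContinuousOn x (Set.Ici 0)) (j k : Fin N) :
    AEStronglyMeasurable (influence A x j k) (volume.restrict (Set.Ici 0)) := by
  have hxj : ∀ i, AEStronglyMeasurable (fun s => x s i) (volume.restrict (Set.Ici 0)) := fun i =>
    ((continuous_apply i).comp_continuousOn hx).aestronglyMeasurable measurableSet_Ici
  exact ((hA.1 j k).aestronglyMeasurable.mul (hxj k)).sub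
    ((hA.1 j k).norm.aestronglyMeasurable.mul (hxj j))

lemma influence_bounded {N : ℕ} {A : ℝ → Matrix (Fin N) (Fin N) ℝ}
    (hA : IsAdjacency A) {x : ℝ → Fin N → ℝ} (hx : ContinuousOn x (Set.Ici 0)) (T : ℝ) :
    ∃ C, 0 ≤ C ∧ ∀ s ∈ Set.Icc 0 T, ∀ j k, |influence A x j k s| ≤ C := by
  obtain ⟨C, hC⟩ := hA.2.1 T
  obtain ⟨M, hM⟩ := isCompact_Icc.exists_bound_of_continuousOn
    (hx.mono (Set.Icc_subset_Ici_self : Set.Icc 0 T ⊆ _))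
  refine ⟨|C| * |M| + |C| * |M|, by positivity, fun s hs j k => ?_⟩
  have hxs : ∀ i, |x s i| ≤ |M| := fun i =>
    (norm_le_pi_norm (x s) i).trans ((hM s hs).trans (le_abs_self M))
  have hAs : |A s j k| ≤ |C| := (hC s hs j k).trans (le_abs_self C)
  refine (abs_sub _ _).trans ?_
  rw [abs_mul, abs_mul, abs_abs]
  exact add_le_add (mul_le_mul hAs (hxs k) (abs_nonneg _) (abs_nonneg _))
    (mul_le_mul hAs (hxs j) (abs_nonneg _) (abs_nonneg _))

lemma influence_integrableOn {N : ℕ} {A : ℝ → Matrix (Fin N) (Fin N) ℝ}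
    (hA : IsAdjacency A) {x : ℝ → Fin N → ℝ} (hx : ContinuousOn x (Set.Ici 0)) (j k : Fin N)
    (T : ℝ) : IntegrableOn (influence A x j k) (Set.Icc 0 T) := by
  obtain ⟨C, -, hC⟩ := influence_bounded hA hx T
  refine IntegrableOn.of_bound (by simp) ((influence_aestronglyMeasurable hA hx j k).mono_measure
    (Measure.restrict_mono Set.Icc_subset_Ici_self le_rfl)) C ?_
  filter_upwards [ae_restrict_mem measurableSet_Icc] with s hs using hC s hs j k

lemma influence_intervalIntegrable {N : ℕ} {A : ℝ → Matrix (Fin N) (Fin N) ℝ}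
    (hA : IsAdjacency A) {x : ℝ → Fin N → ℝ} (hx : ContinuousOn x (Set.Ici 0)) (j k : Fin N)
    {a b : ℝ} (ha : 0 ≤ a) (hb : 0 ≤ b) : IntervalIntegrable (influence A x j k) volume a b := by
  rw [intervalIntegrable_iff]
  refine (influence_integrableOn hA hx j k (max a b)).mono_set fun s hs => ?_
  rw [Set.mem_uIoc] at hs
  rcases hs with hs | hs
  · exact ⟨by linarith, hs.2.trans (le_max_right _ _)⟩
  · exact ⟨by linarith, hs.2.trans (le_max_left _ _)⟩

lemma IsSolution.apply_eq {N : ℕ} {A : ℝ → Matrix (Fin N) (Fin N) ℝ} (hA : IsAdjacency A)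
    {x : ℝ → Fin N → ℝ} (hx : IsSolution A x) {t : ℝ} (ht : 0 ≤ t) (j : Fin N) :
    x t j = x 0 j + ∫ s in (0 : ℝ)..t, ∑ k, influence A x j k s := by
  simp only [hx.2 t ht j, neg_sLap_mulVec hA]

lemma sum_influence_intervalIntegrable {N : ℕ} {A : ℝ → Matrix (Fin N) (Fin N) ℝ}
    (hA : IsAdjacency A) {x : ℝ → Fin N → ℝ} (hx : ContinuousOn x (Set.Ici 0)) (j : Fin N)
    {a b : ℝ} (ha : 0 ≤ a) (hb : 0 ≤ b) :
    IntervalIntegrable (fun s => ∑ k, influence A x j k s) volume a b := by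
  simpa only [Finset.sum_fn] using IntervalIntegrable.sum Finset.univ fun k _ =>
    influence_intervalIntegrable hA hx j k ha hb

lemma IsSolution.exists_lipschitzOnWith {N : ℕ} {A : ℝ → Matrix (Fin N) (Fin N) ℝ}
    (hA : IsAdjacency A) {x : ℝ → Fin N → ℝ} (hx : IsSolution A x) (T : ℝ) :
    ∃ C, LipschitzOnWith C x (Set.Icc 0 T) := by
  obtain ⟨C, hC0, hC⟩ := influence_bounded hA hx.1 T
  have hNC : 0 ≤ N * C := by positivity
  refine ⟨(N * C).toNNReal, LipschitzOnWith.of_dist_le_mul fun s hs t ht => ?_⟩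
  rw [Real.coe_toNNReal _ hNC, dist_pi_le_iff (mul_nonneg hNC dist_nonneg)]
  intro j
  have hi : ∀ {a b : ℝ}, 0 ≤ a → 0 ≤ b → _ := fun ha hb =>
    sum_influence_intervalIntegrable hA hx.1 j ha hb
  rw [hx.apply_eq hA hs.1 j, hx.apply_eq hA ht.1 j, dist_add_left, Real.dist_eq,
    intervalIntegral.integral_interval_sub_left (hi le_rfl hs.1) (hi le_rfl ht.1)]
  change ‖∫ r in t..s, ∑ k, influence A x j k r‖ ≤ N * C * |s - t|
  refine intervalIntegral.norm_integral_le_of_norm_le_const fun r hr => ?_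
  have hr' : r ∈ Set.Icc 0 T := by
    rw [Set.mem_uIoc] at hr
    rcases hr with hr | hr
    · exact ⟨by linarith [ht.1], hr.2.trans hs.2⟩
    · exact ⟨by linarith [hs.1], hr.2.trans ht.2⟩
  refine (norm_sum_le _ _).trans ((Finset.sum_le_sum fun k _ => hC r hr' j k).trans ?_)
  simp

lemma IsSolution.ae_hasDerivAt {N : ℕ} {A : ℝ → Matrix (Fin N) (Fin N) ℝ}
    (hA : IsAdjacency A) {x : ℝ → Fin N → ℝ} (hx : IsSolution A x) {T : ℝ} (hT : 0 ≤ T) :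
    ∀ᵐ t, t ∈ Set.Icc 0 T → HasDerivAt x (fun j => ∑ k, influence A x j k t) t := by
  have h1 : ∀ᵐ t : ℝ, ∀ j, t ∈ Set.uIcc 0 T → ∀ c ∈ Set.uIcc 0 T,
      HasDerivAt (fun t => ∫ s in c..t, ∑ k, influence A x j k s) (∑ k, influence A x j k t) t :=
    ae_all_iff.2 fun j =>
      (sum_influence_intervalIntegrable hA hx.1 j le_rfl hT).ae_hasDerivAt_integral
  have h0 : ∀ᵐ t : ℝ, t ≠ 0 := by simp [ae_iff, measure_singleton]
  filter_upwards [h1, h0] with t h1 h0 ht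
  rw [hasDerivAt_pi]
  intro j
  have h2 := (h1 j (by rwa [Set.uIcc_of_le hT]) 0 Set.left_mem_uIcc).const_add (x 0 j)
  refine h2.congr_of_eventuallyEq ?_
  filter_upwards [lt_mem_nhds (lt_of_le_of_ne ht.1 h0.symm)] with s hs
  exact hx.apply_eq hA hs.le j

/-- Danskin-type identity: wherever the Lyapunov function is differentiable along a differentiable
curve, its derivative is that of any active functional. -/
lemma deriv_norm_rankMap_eq {N : ℕ} {q : ℝ} {x : ℝ → Fin N → ℝ} {v : Fin N → ℝ} {t : ℝ}
    (hv : HasDerivAt x v t) (hF : DifferentiableAt ℝ (fun s => ‖rankMap q (x s)‖) t)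
    {p : Equiv.Perm (Fin N) × (Fin N → SignType)}
    (hp : ‖rankMap q (x t)‖ = rankFunctional q p (x t)) :
    deriv (fun s => ‖rankMap q (x s)‖) t = rankFunctional q p v := by
  have hmin : IsLocalMin (fun s => ‖rankMap q (x s)‖ - rankFunctional q p (x s)) t := by
    refine Filter.Eventually.of_forall fun s => ?_
    have := (le_abs_self _).trans (abs_rankFunctional_le q p (x s))
    simp only [hp, sub_self]
    linarith
  have hd := hF.hasDerivAt.sub ((rankFunctional q p).hasFDerivAt.comp_hasDerivAt t hv)
  have := hmin.hasDerivAt_eq_zero hd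
  linarith

/-- The total disagreement `∑ |a_{jk}| |sgn(a_{jk}) x_k - x_j|` is integrable along solutions. -/
lemma influence_integrableOn_Ici {N : ℕ} (hN : 0 < N) {A : ℝ → Matrix (Fin N) (Fin N) ℝ}
    (hA : IsAdjacency A) (hCB : CutBalanced A) {x : ℝ → Fin N → ℝ} (hx : IsSolution A x)
    (j k : Fin N) : IntegrableOn (influence A x j k) (Set.Ici 0) := by
  obtain ⟨K, hK, hcb⟩ := hCB
  set q : ℝ := (2 * K)⁻¹ with hq
  set δ : ℝ := q ^ N / (2 * (K + 1)) with hδ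
  have hδ0 : 0 < δ := by positivity
  set h : ℝ → ℝ := fun s => ∑ j, ∑ k, |influence A x j k s|
  have hhint : ∀ T, 0 ≤ T → IntervalIntegrable h volume 0 T := fun T hT => by
    have : ∀ j ∈ Finset.univ, IntervalIntegrable (fun s => ∑ k, |influence A x j k s|) volume 0 T := by
      intro j _
      simpa only [Finset.sum_fn] using IntervalIntegrable.sum Finset.univ fun k _ =>
        (influence_intervalIntegrable hA hx.1 j k le_rfl hT).abs
    simpa only [Finset.sum_fn] using IntervalIntegrable.sum Finset.univ this
  have hcb' : ∀ᵐ t, t ∈ Set.Ici (0 : ℝ) → _ := (ae_restrict_iff' measurableSet_Ici).1 hcb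
  have key : ∀ T, 0 ≤ T → ∫ s in (0 : ℝ)..T, h s ≤ ‖rankMap q (x 0)‖ / δ := by
    intro T hT
    obtain ⟨C, hC⟩ := hx.exists_lipschitzOnWith hA T
    have hF : AbsolutelyContinuousOnInterval (fun s => ‖rankMap q (x s)‖) 0 T := by
      refine LipschitzOnWith.absolutelyContinuousOnInterval
        (K := 1 * (‖rankMap (N := N) q‖₊ * C)) ?_
      rw [Set.uIcc_of_le hT]
      exact lipschitzWith_one_norm.comp_lipschitzOnWith
        ((rankMap (N := N) q).lipschitz.comp_lipschitzOnWith hC)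
    have hle : ∫ s in (0 : ℝ)..T, deriv (fun s => ‖rankMap q (x s)‖) s ≤
        ∫ s in (0 : ℝ)..T, -δ * h s := by
      refine intervalIntegral.integral_mono_ae_restrict hT hF.intervalIntegrable_deriv
        ((hhint T hT).const_mul _) ?_
      refine (ae_restrict_iff' measurableSet_Icc).2 ?_
      filter_upwards [hcb', hF.ae_differentiableAt, hx.ae_hasDerivAt hA hT] with t h1 h2 h3 ht
      obtain ⟨p, hp, hpd⟩ := exists_active_functional hN hK
        (fun V hV hV' => (h1 ht.1 V hV hV').1) hq hδ (x t)
      rw [deriv_norm_rankMap_eq (h3 ht) (h2 (by rwa [Set.uIcc_of_le hT])) hp]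
      exact hpd
    rw [hF.integral_deriv_eq_sub, intervalIntegral.integral_const_mul] at hle
    rw [le_div_iff₀ hδ0]
    linarith [norm_nonneg (rankMap q (x T))]
  have hhI : IntegrableOn h (Set.Ioi 0) := by
    refine integrableOn_Ioi_of_intervalIntegral_norm_bounded (‖rankMap q (x 0)‖ / δ) 0
      (l := (atTop : Filter ℕ)) (b := fun n => (n : ℝ))
      (fun n => (intervalIntegrable_iff_integrableOn_Ioc_of_le n.cast_nonneg).1
        (hhint n n.cast_nonneg)) tendsto_natCast_atTop_atTop
      (Filter.Eventually.of_forall fun n => ?_)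
    refine le_trans (le_of_eq ?_) (key n n.cast_nonneg)
    refine intervalIntegral.integral_congr fun s _ => ?_
    exact Real.norm_of_nonneg (Finset.sum_nonneg fun j _ => Finset.sum_nonneg fun k _ => abs_nonneg _)
  refine Integrable.mono' (integrableOn_Ici_iff_integrableOn_Ioi (by simp) |>.2 hhI)
    (influence_aestronglyMeasurable hA hx.1 j k) (Filter.Eventually.of_forall fun s => ?_)
  exact (Finset.single_le_sum (f := fun k => |influence A x j k s|) (fun k _ => abs_nonneg _)
    (Finset.mem_univ k)).trans (Finset.single_le_sum (f := fun j => ∑ k, |influence A x j k s|)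
      (fun j _ => Finset.sum_nonneg fun k _ => abs_nonneg _) (Finset.mem_univ j))

lemma IsSolution.exists_tendsto {N : ℕ} (hN : 0 < N) {A : ℝ → Matrix (Fin N) (Fin N) ℝ}
    (hA : IsAdjacency A) (hCB : CutBalanced A) {x : ℝ → Fin N → ℝ} (hx : IsSolution A x)
    (j : Fin N) : ∃ c, Tendsto (fun t => x t j) atTop (𝓝 c) := by
  have hI : IntegrableOn (fun s => ∑ k, influence A x j k s) (Set.Ioi 0) :=
    integrable_finsetSum _ fun k _ =>
      (influence_integrableOn_Ici hN hA hCB hx j k).mono_set Set.Ioi_subset_Ici_self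
  refine ⟨_, ((intervalIntegral_tendsto_integral_Ioi 0 hI tendsto_id).const_add (x 0 j)).congr' ?_⟩
  filter_upwards [eventually_ge_atTop 0] with t ht
  exact (hx.apply_eq hA ht j).symm

/-- If `p` has infinite integral and `p |y|` is dominated by an integrable function, then a limit
of `y` must vanish. -/
lemma limit_eq_zero_of_lintegral_eq_top {p y g C : ℝ → ℝ} (hp : ∀ t, 0 ≤ p t)
    (hC : ∀ T, ∀ t ∈ Set.Icc 0 T, p t ≤ C T)
    (htop : ∫⁻ t in Set.Ici (0 : ℝ), ENNReal.ofReal (p t) = ⊤)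
    (hg : IntegrableOn g (Set.Ici 0)) (hpg : ∀ t, p t * |y t| ≤ |g t|) {l : ℝ}
    (hy : Tendsto y atTop (𝓝 l)) : l = 0 := by
  by_contra hl
  have hl0 : 0 < |l| := abs_pos.2 hl
  obtain ⟨T, hT⟩ := Filter.eventually_atTop.1 (hy.abs.eventually (lt_mem_nhds (half_lt_self hl0)))
  set T' := max T 0
  refine absurd htop (ne_of_lt ?_)
  have hsub : Set.Ici (0 : ℝ) ⊆ Set.Icc 0 T' ∪ Set.Ici T' := fun t ht => by
    rcases le_total t T' with h | h
    · exact Or.inl ⟨ht, h⟩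
    · exact Or.inr h
  refine (lintegral_mono_set hsub).trans_lt ((lintegral_union_le _ _ _).trans_lt
    (ENNReal.add_lt_top.2 ⟨?_, ?_⟩))
  · refine (setLIntegral_mono' (g := fun _ => ENNReal.ofReal (C T')) measurableSet_Icc
      fun t ht => ENNReal.ofReal_le_ofReal (hC T' t ht)).trans_lt ?_
    simp [ENNReal.mul_lt_top_iff]
  · have h1 : ∫⁻ t in Set.Ici T', ENNReal.ofReal (p t) ≤
        ∫⁻ t in Set.Ici T', ENNReal.ofReal ‖2 / |l| * g t‖ := by
      refine setLIntegral_mono' measurableSet_Ici fun t ht => ENNReal.ofReal_le_ofReal ?_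
      have h2 := hT t ((le_max_left _ _).trans ht)
      rw [norm_mul, Real.norm_of_nonneg (by positivity), Real.norm_eq_abs, div_mul_eq_mul_div,
        le_div_iff₀ hl0]
      nlinarith [hpg t, hp t]
    refine h1.trans_lt ?_
    have h3 : IntegrableOn (fun t => 2 / |l| * g t) (Set.Ici T') :=
      (hg.mono_set (Set.Ici_subset_Ici.2 (le_max_right _ _))).const_mul _
    simp only [ofReal_norm]
    exact h3.2

lemma max_zero_mul_abs_le {a u v : ℝ} :
    max a 0 * |u - v| ≤ |a * u - |a| * v| ∧ max (-a) 0 * |u + v| ≤ |a * u - |a| * v| := by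
  rcases le_total 0 a with h | h
  · rw [max_eq_left h, max_eq_right (by linarith), abs_of_nonneg h, ← mul_sub, abs_mul,
      abs_of_nonneg h]
    exact ⟨le_rfl, by rw [zero_mul]; positivity⟩
  · have h1 : a * u - |a| * v = a * (u + v) := by rw [abs_of_nonpos h]; ring
    rw [max_eq_right h, max_eq_left (by linarith), h1, abs_mul, abs_of_nonpos h]
    exact ⟨by rw [zero_mul]; exact mul_nonneg (by linarith) (abs_nonneg _), le_rfl⟩

lemma IsSolution.limit_eq_of_essPlus {N : ℕ} (hN : 0 < N) {A : ℝ → Matrix (Fin N) (Fin N) ℝ}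
    (hA : IsAdjacency A) (hCB : CutBalanced A) {x : ℝ → Fin N → ℝ} (hx : IsSolution A x)
    {j k : Fin N} {cj ck : ℝ} (hj : Tendsto (fun t => x t j) atTop (𝓝 cj))
    (hk : Tendsto (fun t => x t k) atTop (𝓝 ck)) (h : EssPlus A j k) : cj = ck := by
  choose C hC using hA.2.1
  have := limit_eq_zero_of_lintegral_eq_top (p := fun t => max (A t j k) 0) (C := C)
    (fun t => le_max_right _ _)
    (fun T t ht => (max_le (le_abs_self _) (abs_nonneg _)).trans (hC T t ht j k)) h
    (influence_integrableOn_Ici hN hA hCB hx j k) (fun t => max_zero_mul_abs_le.1) (hk.sub hj)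
  linarith

lemma IsSolution.limit_eq_neg_of_essMinus {N : ℕ} (hN : 0 < N)
    {A : ℝ → Matrix (Fin N) (Fin N) ℝ} (hA : IsAdjacency A) (hCB : CutBalanced A)
    {x : ℝ → Fin N → ℝ} (hx : IsSolution A x) {j k : Fin N} {cj ck : ℝ}
    (hj : Tendsto (fun t => x t j) atTop (𝓝 cj)) (hk : Tendsto (fun t => x t k) atTop (𝓝 ck))
    (h : EssMinus A j k) : cj = -ck := by
  choose C hC using hA.2.1
  have := limit_eq_zero_of_lintegral_eq_top (p := fun t => max (-(A t j k)) 0) (C := C)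
    (fun t => le_max_right _ _)
    (fun T t ht => (max_le (neg_le_abs _) (abs_nonneg _)).trans (hC T t ht j k)) h
    (influence_integrableOn_Ici hN hA hCB hx j k) (fun t => max_zero_mul_abs_le.2) (hk.add hj)
  linarith

lemma essPlus_or_essMinus {N : ℕ} {A : ℝ → Matrix (Fin N) (Fin N) ℝ} (hA : IsAdjacency A)
    {j k : Fin N} (h : EssArc A j k) : EssPlus A j k ∨ EssMinus A j k := by
  have hsplit : ∀ t, ENNReal.ofReal |A t j k| =
      ENNReal.ofReal (max (A t j k) 0) + ENNReal.ofReal (max (-(A t j k)) 0) := by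
    intro t
    rw [← ENNReal.ofReal_add (le_max_right _ _) (le_max_right _ _)]
    congr 1
    rcases le_total 0 (A t j k) with h | h
    · rw [abs_of_nonneg h, max_eq_left h, max_eq_right (by linarith), add_zero]
    · rw [abs_of_nonpos h, max_eq_right h, max_eq_left (by linarith), zero_add]
  simp only [EssArc, hsplit] at h
  rw [lintegral_add_left ((hA.1 j k).max measurable_const).ennreal_ofReal] at h
  exact ENNReal.add_eq_top.1 h

/-- for a cut-balanced graph and a strongly connected component `Vr` of the
graph of essential interactions, opinions converge, moduli agree on `Vr`; if the pairs inside
`Vr` never both essentially cooperate and compete and the component's signed graph is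
structurally balanced with camps given by `S`, the limits agree inside a camp and are opposite
between camps (consensus on `Vr` when there is no essential competition, polarization
otherwise); and in the remaining (unbalanced) case all limits in `Vr` vanish. -/
theorem stmt19 {N : ℕ} (hN : 2 ≤ N) (A : ℝ → Matrix (Fin N) (Fin N) ℝ)
    (hA : IsAdjacency A) (hCB : CutBalanced A)
    (i0 : Fin N) (Vr : Set (Fin N))
    (hVr : Vr = {j | EssReach A i0 j ∧ EssReach A j i0})
    (x : ℝ → Fin N → ℝ) (hx : IsSolution A x) :
    ∃ xd : Fin N → ℝ,
      (∀ i, Tendsto (fun t => x t i) atTop (𝓝 (xd i))) ∧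
      (∀ i ∈ Vr, ∀ j ∈ Vr, |xd i| = |xd j|) ∧
      ((∀ i ∈ Vr, ∀ j ∈ Vr, ¬(EssPlus A i j ∧ EssMinus A i j)) →
        ∀ S : Set (Fin N),
          (∀ i ∈ Vr, ∀ j ∈ Vr, EssPlus A i j → (i ∈ S ↔ j ∈ S)) →
          (∀ i ∈ Vr, ∀ j ∈ Vr, EssMinus A i j → ¬(i ∈ S ↔ j ∈ S)) →
          (∀ i ∈ Vr, ∀ j ∈ Vr, (i ∈ S ↔ j ∈ S) → xd i = xd j) ∧
          (∀ i ∈ Vr, ∀ j ∈ Vr, i ∈ S → j ∉ S → xd i = -xd j)) ∧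
      (((∃ i ∈ Vr, ∃ j ∈ Vr, EssPlus A i j ∧ EssMinus A i j) ∨
          ¬∃ S : Set (Fin N),
            (∀ i ∈ Vr, ∀ j ∈ Vr, EssPlus A i j → (i ∈ S ↔ j ∈ S)) ∧
            (∀ i ∈ Vr, ∀ j ∈ Vr, EssMinus A i j → ¬(i ∈ S ↔ j ∈ S))) →
        ∀ i ∈ Vr, xd i = 0) := by
  have hN0 : 0 < N := by omega
  choose xd hxd using fun i => hx.exists_tendsto hN0 hA hCB i
  have hplus : ∀ j k, EssPlus A j k → xd j = xd k := fun j k =>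
    hx.limit_eq_of_essPlus hN0 hA hCB (hxd j) (hxd k)
  have hminus : ∀ j k, EssMinus A j k → xd j = -xd k := fun j k =>
    hx.limit_eq_neg_of_essMinus hN0 hA hCB (hxd j) (hxd k)
  have habs0 : ∀ j, EssReach A i0 j → |xd j| = |xd i0| := by
    intro j hj
    induction hj with
    | refl => rfl
    | tail _ hbc ih =>
      rcases essPlus_or_essMinus hA hbc with h | h
      · rw [hplus _ _ h, ih]
      · rw [hminus _ _ h, abs_neg, ih]
  have habs : ∀ i ∈ Vr, ∀ j ∈ Vr, |xd i| = |xd j| := by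
    rw [hVr]
    exact fun i hi j hj => (habs0 i hi.1).trans (habs0 j hj.1).symm
  refine ⟨xd, hxd, habs, fun _ S hSp hSm => ?_, fun hunb => ?_⟩
  · have hcamp0 : ∀ j, EssReach A i0 j → EssReach A j i0 →
        ((i0 ∈ S ↔ j ∈ S) → xd j = xd i0) ∧ (¬(i0 ∈ S ↔ j ∈ S) → xd j = -xd i0) := by
      intro j hj
      induction hj with
      | refl => simp
      | @tail b c hb hbc ih =>
        intro hc
        have hb' : EssReach A b i0 := Relation.ReflTransGen.head hbc hc
        have hbV : b ∈ Vr := by rw [hVr]; exact ⟨hb, hb'⟩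
        have hcV : c ∈ Vr := by rw [hVr]; exact ⟨Relation.ReflTransGen.tail hb hbc, hc⟩
        obtain ⟨ih1, ih2⟩ := ih hb'
        rcases essPlus_or_essMinus hA hbc with h | h
        · have h1 := hSp c hcV b hbV h
          rw [hplus c b h]
          exact ⟨fun h2 => ih1 (h2.trans h1), fun h2 => ih2 fun h3 => h2 (h3.trans h1.symm)⟩
        · have h1 := hSm c hcV b hbV h
          rw [hminus c b h]
          refine ⟨fun h2 => ?_, fun h2 => ?_⟩
          · rw [ih2 (by tauto), neg_neg]
          · rw [ih1 (by tauto)]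
    have hcamp : ∀ j ∈ Vr, ((i0 ∈ S ↔ j ∈ S) → xd j = xd i0) ∧
        (¬(i0 ∈ S ↔ j ∈ S) → xd j = -xd i0) := by
      rw [hVr]
      exact fun j hj => hcamp0 j hj.1 hj.2
    refine ⟨fun i hi j hj hij => ?_, fun i hi j hj hiS hjS => ?_⟩
    · by_cases h : i0 ∈ S ↔ i ∈ S
      · rw [(hcamp i hi).1 h, (hcamp j hj).1 (h.trans hij)]
      · rw [(hcamp i hi).2 h, (hcamp j hj).2 (by tauto)]
    · by_cases h : i0 ∈ S
      · rw [(hcamp i hi).1 (by tauto), (hcamp j hj).2 (by tauto), neg_neg]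
      · rw [(hcamp i hi).2 (by tauto), (hcamp j hj).1 (by tauto)]
  · intro i hi
    by_contra hne
    have hne' : ∀ j ∈ Vr, xd j ≠ 0 := fun j hj h0 => by
      have := habs i hi j hj
      rw [h0, abs_zero, abs_eq_zero] at this
      exact hne this
    rcases hunb with ⟨j, hj, k, hk, hp, hm⟩ | hS
    · have h1 := hplus j k hp
      have h2 := hminus j k hm
      exact hne' j hj (by linarith)
    · refine hS ⟨{j | 0 < xd j}, fun j _ k _ h => ?_, fun j hj k _ h => ?_⟩
      · simp [hplus j k h]
      · have h1 := hminus j k h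
        have h2 := hne' j hj
        intro h3
        simp only [Set.mem_ofPred_eq] at h3
        rcases lt_or_gt_of_ne h2 with h4 | h4
        · have := h3.2 (by linarith)
          linarith
        · have := h3.1 h4
          linarith
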